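/- H¹ → L² bound for the nonlinear part of the Lax operator (deep-water case, i.e. the s = 0 case of the mapping bound ‖L_{u}‖_{H^{s+1}→H^{s}} ≲ 1 + ‖u‖²_{W^{s,4}}): there exists a constant C > 0 such that for all Schwartz functions u, f : ℝ → ℂ, ‖ u · P₊(conj(u)·f) ‖_{L²(ℝ)} ≤ C · ‖u‖_{L⁴(ℝ)}² · ( ‖f‖_{L²(ℝ)}² + ‖f′‖_{L²(ℝ)}² )^{1/2}. Consequently ‖ −i f′ + β·u·P₊(conj(u)·f) ‖_{L²} ≤ (1 + C‖u‖_{L⁴}²)·( ‖f‖_{L²}² + ‖f′‖_{L²}² )^{1/2} for every β with |β| ≤ 1. -/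

import Mathlib

open MeasureTheory Complex

/-- The Fourier transform, normalized as `ĝ(ξ) = (2π)^{-1/2} ∫ g(y) e^{-iyξ} dy`. -/
noncomputable def FT (f : ℝ → ℂ) (ξ : ℝ) : ℂ :=
  (Real.sqrt (2 * Real.pi))⁻¹ • ∫ x : ℝ, f x * Complex.exp (-(Complex.I * x * ξ))

/-- The positive-frequency (Szegő) projection
`(P₊g)(x) = (2π)^{-1/2} ∫_0^∞ ĝ(ξ) e^{ixξ} dξ`. -/
noncomputable def Pplus (g : ℝ → ℂ) (x : ℝ) : ℂ :=
  (Real.sqrt (2 * Real.pi))⁻¹ • ∫ ξ in Set.Ioi (0 : ℝ), FT g ξ * Complex.exp (Complex.I * x * ξ)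

open scoped FourierTransform Convolution SchwartzMap

namespace LaxAux

/-- Restriction to positive frequencies. -/
noncomputable def cut (a : ℝ → ℂ) : ℝ → ℂ := (Set.Ioi (0 : ℝ)).indicator a

lemma cut_integrable (a : 𝓢(ℝ, ℂ)) : Integrable (cut a) :=
  a.integrable.indicator measurableSet_Ioi

lemma orth {p q : ℝ → ℂ} (hp : Integrable p) (hq : Integrable q)
    (hp0 : ∀ x ≤ 0, p x = 0) (hq0 : ∀ x ≤ 0, q x = 0) (hq' : Integrable (𝓕 q)) :
    ∫ x, 𝓕 p x * 𝓕 q x = 0 := by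
  have h1 : ∫ x, 𝓕 p x * 𝓕 q x = ∫ x, p x * 𝓕 (𝓕 q) x := by
    simpa using! (VectorFourier.integral_fourierIntegral_smul_eq_flip (L := innerₗ ℝ)
      Real.continuous_fourierChar continuous_inner hp hq')
  rw [h1]
  have : ∀ x, p x * 𝓕 (𝓕 q) x = 0 := by
    intro x
    rcases le_or_gt x 0 with hx | hx
    · simp [hp0 x hx]
    · have hc : ContinuousAt q (-x) := by
        have : q =ᶠ[nhds (-x)] fun _ => 0 := by
          filter_upwards [Iio_mem_nhds (show -x < 0 by linarith)] with y hy
          exact hq0 y (le_of_lt hy)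
        exact this.continuousAt
      have := hq.fourierInv_fourier_eq hq' hc
      rw [Real.fourierInv_eq_fourier_neg, neg_neg, hq0 (-x) (by linarith)] at this
      simp [this]
  simp [this]

lemma cont_fourier {p : ℝ → ℂ} (hp : Integrable p) : Continuous (𝓕 p) :=
  VectorFourier.fourierIntegral_continuous (L := innerₗ ℝ)
      Real.continuous_fourierChar continuous_inner hp

lemma fourier_cut (a : ℝ → ℂ) (x : ℝ) :
    𝓕 (cut a) x = ∫ v in Set.Ioi (0:ℝ), cexp (-2 * Real.pi * I * x * v) * a v := by
  rw [Real.fourier_real_eq_integral_exp_smul, ← integral_indicator measurableSet_Ioi]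
  congr 1; ext v
  unfold cut
  by_cases hv : v ∈ Set.Ioi (0:ℝ)
  · simp only [Set.indicator_of_mem hv, smul_eq_mul]
    congr 2; push_cast; ring
  · simp [Set.indicator_of_notMem hv]

lemma norm_e (x v : ℝ) : ‖cexp (-2 * Real.pi * I * x * v)‖ = 1 := by
  have : (-2 * Real.pi * I * x * v : ℂ) = ((-2 * Real.pi * x * v : ℝ) : ℂ) * I := by
    push_cast; ring
  rw [this, norm_exp_ofReal_mul_I]

lemma cont_e (x : ℝ) : Continuous fun v : ℝ => cexp (-2 * Real.pi * I * x * v) := by fun_prop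

lemma int_e (a : 𝓢(ℝ, ℂ)) (x : ℝ) :
    Integrable (fun v : ℝ => cexp (-2 * Real.pi * I * x * v) * a v) := by
  refine a.integrable.norm.mono' ((cont_e x).mul a.continuous).aestronglyMeasurable ?_
  filter_upwards with v
  rw [norm_mul, norm_e, one_mul]

lemma bound_e (a : 𝓢(ℝ, ℂ)) (x : ℝ) :
    ‖∫ v in Set.Ioi (0:ℝ), cexp (-2 * Real.pi * I * x * v) * a v‖ ≤ ∫ v, ‖a v‖ := by
  refine (norm_integral_le_integral_norm _).trans ?_
  simp only [norm_mul, norm_e, one_mul]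
  exact setIntegral_le_integral a.integrable.norm (by filter_upwards with v; positivity)

lemma schwartz_top (a : 𝓢(ℝ, ℂ)) : Filter.Tendsto a Filter.atTop (nhds 0) :=
  a.tendsto_cocompact.mono_left atTop_le_cocompact

lemma schwartz_bot (a : 𝓢(ℝ, ℂ)) : Filter.Tendsto a Filter.atBot (nhds 0) :=
  a.tendsto_cocompact.mono_left atBot_le_cocompact

lemma decay (a : 𝓢(ℝ, ℂ)) :
    ∃ C : ℝ, 0 ≤ C ∧ ∀ x, ‖𝓕 (cut a) x‖ ^ 2 ≤ C * (1 + x ^ 2)⁻¹ := by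
  set a' := SchwartzMap.derivCLM ℂ ℂ a with ha'
  set A := ∫ v, ‖a v‖
  set B := ‖a 0‖ + ∫ v, ‖a' v‖
  have hB : 0 ≤ B := add_nonneg (norm_nonneg _) (integral_nonneg fun _ => norm_nonneg _)
  have hA : ∀ x, ‖𝓕 (cut a) x‖ ≤ A := fun x => by rw [fourier_cut]; exact bound_e a x
  have hX : ∀ x : ℝ, |x| * ‖𝓕 (cut a) x‖ ≤ B := by
    intro x
    have hd : ∀ v ∈ Set.Ici (0:ℝ),
        HasDerivAt (fun v : ℝ => cexp (-2 * Real.pi * I * x * v) * a v)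
        ((-2 * Real.pi * I * x) * (cexp (-2 * Real.pi * I * x * v) * a v) +
          cexp (-2 * Real.pi * I * x * v) * a' v) v := by
      intro v _
      have h1 : HasDerivAt (fun v : ℝ => (-2 * Real.pi * I * x * v : ℂ))
          (-2 * Real.pi * I * x) v := by
        simpa using (Complex.ofRealCLM.hasDerivAt (x := v)).const_mul (-2 * Real.pi * I * x : ℂ)
      have h2 := h1.cexp.mul (a.differentiableAt (x := v)).hasDerivAt
      refine h2.congr_deriv ?_
      rw [ha', SchwartzMap.derivCLM_apply]; ring
    have hlim : Filter.Tendsto (fun v : ℝ => cexp (-2 * Real.pi * I * x * v) * a v)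
        Filter.atTop (nhds 0) := by
      rw [tendsto_zero_iff_norm_tendsto_zero]
      simp only [norm_mul, norm_e, one_mul]
      exact (tendsto_zero_iff_norm_tendsto_zero.1 (schwartz_top a))
    have hi1 := ((int_e a x).const_mul (-2 * Real.pi * I * x : ℂ)).integrableOn (s := Set.Ioi 0)
    have hi2 := (int_e a' x).integrableOn (s := Set.Ioi 0)
    have h := integral_Ioi_of_hasDerivAt_of_tendsto' hd (hi1.add hi2) hlim
    rw [integral_add hi1 hi2, integral_const_mul, ← fourier_cut] at h
    simp only [ofReal_zero, mul_zero, Complex.exp_zero, one_mul, zero_sub] at h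
    have h3 : (-2 * Real.pi * I * x) * 𝓕 (cut a) x =
        -(a 0 + ∫ v in Set.Ioi (0:ℝ), cexp (-2 * Real.pi * I * x * v) * a' v) := by
      linear_combination h
    have h4 := congrArg norm h3
    rw [norm_neg, norm_mul] at h4
    have h5 : ‖(-2 * Real.pi * I * x : ℂ)‖ = 2 * Real.pi * |x| := by
      simp [abs_of_pos Real.pi_pos]
    rw [h5] at h4
    have h6 : 2 * Real.pi * |x| * ‖𝓕 (cut a) x‖ ≤ B := by
      rw [h4]
      exact (norm_add_le _ _).trans (add_le_add le_rfl (bound_e a' x))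
    have h7 : 0 ≤ |x| * ‖𝓕 (cut a) x‖ := by positivity
    nlinarith [Real.pi_gt_three]
  refine ⟨A ^ 2 + B ^ 2, by positivity, fun x => ?_⟩
  rw [← div_eq_mul_inv, le_div_iff₀ (by positivity)]
  have h1 : ‖𝓕 (cut a) x‖ ^ 2 ≤ A ^ 2 := pow_le_pow_left₀ (norm_nonneg _) (hA x) 2
  have h2 : (|x| * ‖𝓕 (cut a) x‖) ^ 2 ≤ B ^ 2 := pow_le_pow_left₀ (by positivity) (hX x) 2
  rw [mul_pow, sq_abs] at h2
  nlinarith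

lemma bdd (a : 𝓢(ℝ, ℂ)) : ∃ C : ℝ, 0 ≤ C ∧ ∀ x, ‖𝓕 (cut a) x‖ ^ 2 ≤ C := by
  obtain ⟨C, hC, h⟩ := decay a
  refine ⟨C, hC, fun x => (h x).trans ?_⟩
  have : (1 + x ^ 2)⁻¹ ≤ 1 := inv_le_one_of_one_le₀ (by nlinarith)
  nlinarith

lemma int_sq (a : 𝓢(ℝ, ℂ)) : Integrable fun x => ‖𝓕 (cut a) x‖ ^ 2 := by
  obtain ⟨C, hC, h⟩ := decay a
  have hc := cont_fourier (cut_integrable a)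
  refine (integrable_inv_one_add_sq.const_mul C).mono' (by fun_prop) ?_
  filter_upwards with x
  rw [Real.norm_of_nonneg (by positivity)]
  exact h x

lemma conv_zero (a b : ℝ → ℂ) (x : ℝ) (hx : x ≤ 0) :
    (cut a ⋆[ContinuousLinearMap.mul ℂ ℂ, volume] cut b) x = 0 := by
  by_contra hne
  have := support_convolution_subset (ContinuousLinearMap.mul ℂ ℂ) (μ := volume)
    (f := cut a) (g := cut b) (Function.mem_support.2 hne)
  obtain ⟨y, hy, z, hz, rfl⟩ := Set.mem_add.1 this
  have h1 : y ∈ Set.Ioi (0:ℝ) := Set.support_indicator_subset hy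
  have h2 : z ∈ Set.Ioi (0:ℝ) := Set.support_indicator_subset hz
  simp only [Set.mem_Ioi] at h1 h2
  linarith

lemma orth2 (a b : 𝓢(ℝ, ℂ)) :
    ∫ x, 𝓕 (cut a) x ^ 2 * 𝓕 (cut b) x ^ 2 = 0 := by
  have e : ∀ a : 𝓢(ℝ, ℂ), ∀ x, 𝓕 (cut a) x ^ 2 =
      𝓕 (cut a ⋆[ContinuousLinearMap.mul ℂ ℂ, volume] cut a) x := by
    intro a x
    rw [Real.fourier_mul_convolution_eq (cut_integrable a) (cut_integrable a), sq]
  simp only [e]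
  refine orth ((cut_integrable a).integrable_convolution _ (cut_integrable a))
    ((cut_integrable b).integrable_convolution _ (cut_integrable b))
    (conv_zero a a) (conv_zero b b) ?_
  have : 𝓕 (cut b ⋆[ContinuousLinearMap.mul ℂ ℂ, volume] cut b) =
      fun x => 𝓕 (cut b) x ^ 2 := by ext x; rw [e]
  rw [this]
  have hc := cont_fourier (cut_integrable b)
  refine (int_sq b).mono' (by fun_prop) ?_
  filter_upwards with x
  rw [norm_pow]

lemma Pplus_eq (g : 𝓢(ℝ, ℂ)) (x : ℝ) : Pplus g x = 𝓕 (cut ⇑(𝓕 g : 𝓢(ℝ, ℂ))) (-x) := by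
  have hpi : (0:ℝ) < 2 * Real.pi := by positivity
  have hFT : ∀ v : ℝ, FT g (2 * Real.pi * v) = (Real.sqrt (2 * Real.pi))⁻¹ • 𝓕 (g : ℝ → ℂ) v := by
    intro v
    rw [FT, Real.fourier_real_eq_integral_exp_smul]
    congr 2; ext y
    rw [smul_eq_mul, mul_comm]
    congr 2; push_cast; ring
  have h := integral_comp_mul_left_Ioi (fun ξ : ℝ => FT g ξ * Complex.exp (Complex.I * x * ξ)) 0 hpi
  rw [mul_zero] at h
  have h' : ∫ ξ in Set.Ioi (0 : ℝ), FT g ξ * Complex.exp (Complex.I * x * ξ) =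
      (2 * Real.pi) • ∫ v in Set.Ioi (0 : ℝ), FT g (2 * Real.pi * v) *
        Complex.exp (Complex.I * x * (2 * Real.pi * v : ℝ)) := by
    rw [h, smul_smul, mul_inv_cancel₀ hpi.ne', one_smul]
  rw [Pplus, h', fourier_cut]
  simp only [hFT, smul_mul_assoc]
  rw [integral_smul, smul_smul, smul_smul, mul_assoc]
  have h1 : (Real.sqrt (2 * Real.pi))⁻¹ * (2 * Real.pi * (Real.sqrt (2 * Real.pi))⁻¹) = 1 := by
    have h2 := Real.mul_self_sqrt hpi.le
    have h3 : Real.sqrt (2 * Real.pi) ≠ 0 := (Real.sqrt_pos.2 hpi).ne'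
    field_simp
    linarith
  rw [h1, one_smul]
  congr 1; ext v
  rw [mul_comm, SchwartzMap.fourier_coe]
  congr 2; push_cast; ring

/-- Complex conjugate of a Schwartz function. -/
noncomputable def cj (g : 𝓢(ℝ, ℂ)) : 𝓢(ℝ, ℂ) :=
  SchwartzMap.postcompCLM (Complex.conjCLE : ℂ →L[ℝ] ℂ) g

lemma cj_apply (g : 𝓢(ℝ, ℂ)) (x : ℝ) : cj g x = (starRingEnd ℂ) (g x) := rfl

lemma fourier_cj (g : 𝓢(ℝ, ℂ)) (x : ℝ) :
    (starRingEnd ℂ) (𝓕 (cj g) x) = 𝓕 g (-x) := by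
  rw [SchwartzMap.fourier_coe, SchwartzMap.fourier_coe, Real.fourier_real_eq_integral_exp_smul,
    Real.fourier_real_eq_integral_exp_smul, ← integral_conj]
  congr 1; ext v
  simp only [smul_eq_mul, map_mul, cj_apply, Complex.conj_conj, ← Complex.exp_conj, conj_ofReal,
    conj_I]
  congr 2; push_cast; ring

lemma decomp (g : 𝓢(ℝ, ℂ)) (x : ℝ) :
    g x = 𝓕 (cut ⇑(𝓕 g : 𝓢(ℝ, ℂ))) (-x) + (starRingEnd ℂ) (𝓕 (cut ⇑(𝓕 (cj g) : 𝓢(ℝ, ℂ))) (-x)) := by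
  have h0 : g x = ∫ v : ℝ, cexp (-2 * Real.pi * I * (-x : ℝ) * v) * 𝓕 g v := by
    have hinv : 𝓕⁻ (𝓕 g) = g := FourierTransform.fourierInv_fourier_eq g
    conv_lhs => rw [← hinv]
    rw [SchwartzMap.fourierInv_coe, Real.fourierInv_eq_fourier_neg,
      Real.fourier_real_eq_integral_exp_smul]
    congr 1; ext v
    rw [smul_eq_mul]
    congr 2; push_cast; ring
  have h1 : (starRingEnd ℂ) (𝓕 (cut ⇑(𝓕 (cj g) : 𝓢(ℝ, ℂ))) (-x)) =
      ∫ v in Set.Iic (0:ℝ), cexp (-2 * Real.pi * I * (-x : ℝ) * v) * 𝓕 g v := by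
    rw [fourier_cut, ← integral_conj]
    have := integral_comp_neg_Ioi 0
      (fun v : ℝ => cexp (-2 * Real.pi * I * (-x : ℝ) * v) * 𝓕 g v)
    rw [neg_zero] at this
    rw [← this]
    congr 1; ext v
    rw [map_mul, fourier_cj, ← Complex.exp_conj]
    congr 2
    simp [Complex.conj_ofNat]
  rw [h0, h1, fourier_cut, add_comm]
  have hi := int_e (𝓕 g) (-x)
  rw [← setIntegral_union (Set.Iic_disjoint_Ioi le_rfl) measurableSet_Ioi hi.integrableOn
    hi.integrableOn, Set.Iic_union_Ioi, setIntegral_univ]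

lemma ptwise (F K : ℂ) : ‖F‖ ^ 4 + ‖K‖ ^ 4 ≤
    8 * ‖F + (starRingEnd ℂ) K‖ ^ 4 + 4 * (F ^ 2 * K ^ 2).re := by
  set G := (starRingEnd ℂ) K with hG
  have hK : K = (starRingEnd ℂ) G := by simp [hG]
  have hKn : ‖K‖ = ‖G‖ := by simp [hG]
  have h1 : ‖(F + G) * (F - G)‖ ^ 2 = ‖F‖ ^ 4 + ‖G‖ ^ 4 - 2 * (F ^ 2 * K ^ 2).re := by
    have e : (F + G) * (F - G) = F ^ 2 - G ^ 2 := by ring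
    rw [e, hK]
    rw [← Complex.normSq_eq_norm_sq, Complex.normSq_sub]
    simp only [map_pow, Complex.normSq_eq_norm_sq]
    ring
  rw [norm_mul, mul_pow] at h1
  have h2 : ‖F - G‖ ^ 2 ≤ 2 * (‖F‖ ^ 2 + ‖G‖ ^ 2) := by
    have := norm_sub_le F G
    nlinarith [norm_nonneg (F - G), norm_nonneg F, norm_nonneg G, sq_nonneg (‖F‖ - ‖G‖)]
  rw [hKn]
  have h3 : ‖F + G‖ ^ 2 * ‖F - G‖ ^ 2 ≤ ‖F + G‖ ^ 2 * (2 * (‖F‖ ^ 2 + ‖G‖ ^ 2)) := by gcongr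
  nlinarith [sq_nonneg (2 * ‖F + G‖ ^ 2 - ‖F‖ ^ 2), sq_nonneg (2 * ‖F + G‖ ^ 2 - ‖G‖ ^ 2)]

lemma int_four (a : 𝓢(ℝ, ℂ)) : Integrable fun x => ‖𝓕 (cut a) x‖ ^ 4 := by
  obtain ⟨C, hC, h⟩ := bdd a
  have hc := cont_fourier (cut_integrable a)
  refine ((int_sq a).const_mul C).mono' (by fun_prop) ?_
  filter_upwards with x
  rw [Real.norm_of_nonneg (by positivity)]
  have := h x
  nlinarith [sq_nonneg ‖𝓕 (cut a) x‖]

lemma schwartz_pow (g : 𝓢(ℝ, ℂ)) (n : ℕ) : Integrable fun x => ‖g x‖ ^ (n + 1) := by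
  obtain ⟨C, hC⟩ := g.decay 0 0
  have hb : ∀ x, ‖g x‖ ≤ C := fun x => by simpa using hC.2 x
  refine (g.integrable.norm.const_mul (C ^ n)).mono' (by have := g.continuous; fun_prop) ?_
  filter_upwards with x
  rw [Real.norm_of_nonneg (by positivity), pow_succ]
  have := hb x
  gcongr

lemma riesz4 (g : 𝓢(ℝ, ℂ)) :
    (Integrable fun x => ‖Pplus g x‖ ^ 4) ∧ ∫ x, ‖Pplus g x‖ ^ 4 ≤ 8 * ∫ x, ‖g x‖ ^ 4 := by
  have hF := (int_four (𝓕 g)).comp_neg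
  have hK := (int_four (𝓕 (cj g))).comp_neg
  have hg := schwartz_pow g 3
  have hc1 := cont_fourier (cut_integrable (𝓕 g))
  have hc2 := cont_fourier (cut_integrable (𝓕 (cj g)))
  have ho : ∫ x, 𝓕 (cut ⇑(𝓕 g : 𝓢(ℝ, ℂ))) (-x) ^ 2 * 𝓕 (cut ⇑(𝓕 (cj g) : 𝓢(ℝ, ℂ))) (-x) ^ 2 = 0 := by
    rw [integral_neg_eq_self (fun x => 𝓕 (cut ⇑(𝓕 g : 𝓢(ℝ, ℂ))) x ^ 2 * 𝓕 (cut ⇑(𝓕 (cj g) : 𝓢(ℝ, ℂ))) x ^ 2)]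
    exact orth2 _ _
  have hoi : Integrable fun x => 𝓕 (cut ⇑(𝓕 g : 𝓢(ℝ, ℂ))) (-x) ^ 2 * 𝓕 (cut ⇑(𝓕 (cj g) : 𝓢(ℝ, ℂ))) (-x) ^ 2 := by
    refine (hF.add hK).mono' (by fun_prop) ?_
    filter_upwards with x
    rw [norm_mul, norm_pow, norm_pow]
    simp only [Pi.add_apply]
    nlinarith [sq_nonneg (‖𝓕 (cut ⇑(𝓕 g : 𝓢(ℝ, ℂ))) (-x)‖ ^ 2 - ‖𝓕 (cut ⇑(𝓕 (cj g) : 𝓢(ℝ, ℂ))) (-x)‖ ^ 2),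
      sq_nonneg (‖𝓕 (cut ⇑(𝓕 g : 𝓢(ℝ, ℂ))) (-x)‖ ^ 2), sq_nonneg (‖𝓕 (cut ⇑(𝓕 (cj g) : 𝓢(ℝ, ℂ))) (-x)‖ ^ 2)]
  simp only [Pplus_eq]
  refine ⟨hF, ?_⟩
  have hre : ∫ x, (𝓕 (cut ⇑(𝓕 g : 𝓢(ℝ, ℂ))) (-x) ^ 2 * 𝓕 (cut ⇑(𝓕 (cj g) : 𝓢(ℝ, ℂ))) (-x) ^ 2).re = 0 := by
    have := integral_re hoi
    simp only [RCLike.re_to_complex] at this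
    rw [this, ho]; simp
  have hrei : Integrable fun x => (𝓕 (cut ⇑(𝓕 g : 𝓢(ℝ, ℂ))) (-x) ^ 2 * 𝓕 (cut ⇑(𝓕 (cj g) : 𝓢(ℝ, ℂ))) (-x) ^ 2).re :=
    hoi.re
  calc ∫ x, ‖𝓕 (cut ⇑(𝓕 g : 𝓢(ℝ, ℂ))) (-x)‖ ^ 4
      ≤ ∫ x, (8 * ‖g x‖ ^ 4 + 4 * (𝓕 (cut ⇑(𝓕 g : 𝓢(ℝ, ℂ))) (-x) ^ 2 * 𝓕 (cut ⇑(𝓕 (cj g) : 𝓢(ℝ, ℂ))) (-x) ^ 2).re) := by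
        refine integral_mono hF ((hg.const_mul 8).add (hrei.const_mul 4)) fun x => ?_
        have := ptwise (𝓕 (cut ⇑(𝓕 g : 𝓢(ℝ, ℂ))) (-x)) (𝓕 (cut ⇑(𝓕 (cj g) : 𝓢(ℝ, ℂ))) (-x))
        rw [← decomp] at this
        have h4 : 0 ≤ ‖𝓕 (cut ⇑(𝓕 (cj g) : 𝓢(ℝ, ℂ))) (-x)‖ ^ 4 := by positivity
        simp only
        linarith
    _ = 8 * ∫ x, ‖g x‖ ^ 4 := by
        rw [integral_add (hg.const_mul 8) (hrei.const_mul 4), integral_const_mul,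
          integral_const_mul, hre]
        ring

lemma sobolev (f : 𝓢(ℝ, ℂ)) (x : ℝ) :
    ‖f x‖ ^ 2 ≤ (∫ x, ‖f x‖ ^ 2) + ∫ x, ‖deriv f x‖ ^ 2 := by
  have hi1 := schwartz_pow f 1
  have hi2 := schwartz_pow (SchwartzMap.derivCLM ℂ ℂ f) 1
  simp only [SchwartzMap.derivCLM_apply, Nat.reduceAdd] at hi1 hi2
  have hdc : Continuous (deriv f) := by
    have := (SchwartzMap.derivCLM ℂ ℂ f).continuous
    simpa only [SchwartzMap.derivCLM_apply] using! this
  have hfc := f.continuous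
  have hle : ∀ y, ‖2 * f y * deriv f y‖ ≤ ‖f y‖ ^ 2 + ‖deriv f y‖ ^ 2 := by
    intro y
    simp only [norm_mul, Complex.norm_ofNat]
    nlinarith [sq_nonneg (‖f y‖ - ‖deriv f y‖)]
  have hi : Integrable fun y => 2 * f y * deriv f y := by
    refine (hi1.add hi2).mono' (by fun_prop) ?_
    filter_upwards with y using hle y
  have hd : ∀ y ∈ Set.Iic x, HasDerivAt (fun y => f y ^ 2) (2 * f y * deriv f y) y := by
    intro y _
    have h2 := (f.differentiableAt (x := y)).hasDerivAt.pow 2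
    exact h2.congr_deriv (by simp)
  have h := integral_Iic_of_hasDerivAt_of_tendsto' hd hi.integrableOn
    (by simpa using (schwartz_bot f).pow 2)
  rw [sub_zero] at h
  rw [← norm_pow, ← h, ← integral_add hi1 hi2]
  refine (norm_integral_le_integral_norm _).trans ?_
  refine (setIntegral_le_integral hi.norm (by filter_upwards with v; positivity)).trans ?_
  exact integral_mono hi.norm (hi1.add hi2) hle

lemma cs {a b : ℝ → ℝ} (ha : Integrable fun x => a x ^ 2) (hb : Integrable fun x => b x ^ 2)
    (hab : Integrable fun x => a x * b x) :
    (∫ x, a x * b x) ^ 2 ≤ (∫ x, a x ^ 2) * ∫ x, b x ^ 2 := by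
  have hl : ∀ t : ℝ, Integrable fun x => (t * t) * a x ^ 2 + (2 * t) * (a x * b x) :=
    fun t => (ha.const_mul _).add (hab.const_mul _)
  have h : ∀ t : ℝ, 0 ≤ (∫ x, a x ^ 2) * (t * t) + (2 * ∫ x, a x * b x) * t + ∫ x, b x ^ 2 := by
    intro t
    have h0 : 0 ≤ ∫ x, (t * a x + b x) ^ 2 := integral_nonneg fun x => sq_nonneg _
    have e : (fun x => (t * a x + b x) ^ 2) =
        fun x => ((t * t) * a x ^ 2 + (2 * t) * (a x * b x)) + b x ^ 2 := by ext x; ring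
    rw [e, integral_add (hl t) hb,
      integral_add (ha.const_mul _) (hab.const_mul _), integral_const_mul, integral_const_mul] at h0
    linarith
  have := discrim_le_zero h
  unfold discrim at this
  nlinarith

lemma main (u f : 𝓢(ℝ, ℂ)) :
    Continuous (Pplus (fun y => (starRingEnd ℂ) (u y) * f y)) ∧
    (Integrable fun x => ‖u x * Pplus (fun y => (starRingEnd ℂ) (u y) * f y) x‖ ^ 2) ∧
    ∫ x, ‖u x * Pplus (fun y => (starRingEnd ℂ) (u y) * f y) x‖ ^ 2 ≤
      4 * (∫ x, ‖u x‖ ^ 4) * ((∫ x, ‖f x‖ ^ 2) + ∫ x, ‖deriv f x‖ ^ 2) := by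
  set g : 𝓢(ℝ, ℂ) := SchwartzMap.pairing (ContinuousLinearMap.mul ℂ ℂ) (cj u) f with hg
  have hge : (fun y => (starRingEnd ℂ) (u y) * f y) = g := by
    ext y
    rw [hg, SchwartzMap.pairing_apply_apply]
    rfl
  have hgn : ∀ y, ‖g y‖ = ‖u y‖ * ‖f y‖ := by
    intro y
    rw [← hge]; simp
  rw [hge]
  have hc : Continuous (Pplus g) := by
    have h1 := (cont_fourier (cut_integrable (𝓕 g))).comp continuous_neg
    have h2 : Pplus g = fun x => 𝓕 (cut ⇑(𝓕 g : 𝓢(ℝ, ℂ))) (-x) := by ext x; exact Pplus_eq g x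
    rw [h2]; exact h1
  obtain ⟨hPi, hP⟩ := riesz4 g
  have hui := schwartz_pow u 3
  have hgi := schwartz_pow g 3
  simp only [Nat.reduceAdd] at hui hgi
  have huc := u.continuous
  set N := (∫ x, ‖f x‖ ^ 2) + ∫ x, ‖deriv f x‖ ^ 2 with hN
  set U := ∫ x, ‖u x‖ ^ 4 with hU
  have hN0 : 0 ≤ N := add_nonneg (integral_nonneg fun _ => by positivity)
    (integral_nonneg fun _ => by positivity)
  have hU0 : 0 ≤ U := integral_nonneg fun _ => by positivity
  have hgU : ∫ x, ‖g x‖ ^ 4 ≤ N ^ 2 * U := by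
    rw [hU, ← integral_const_mul]
    refine integral_mono hgi (hui.const_mul _) fun x => ?_
    have h1 : ‖f x‖ ^ 2 ≤ N := sobolev f x
    have h2 : (‖f x‖ ^ 2) ^ 2 ≤ N ^ 2 := pow_le_pow_left₀ (by positivity) h1 2
    have h3 : ‖g x‖ ^ 4 = (‖f x‖ ^ 2) ^ 2 * ‖u x‖ ^ 4 := by rw [hgn]; ring
    simp only [h3]
    gcongr
  have hi : Integrable fun x => ‖u x‖ ^ 2 * ‖Pplus g x‖ ^ 2 := by
    refine (hui.add hPi).mono' (by fun_prop) ?_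
    filter_upwards with x
    rw [Real.norm_of_nonneg (by positivity)]
    simp only [Pi.add_apply]
    nlinarith [sq_nonneg (‖u x‖ ^ 2 - ‖Pplus g x‖ ^ 2), sq_nonneg (‖u x‖ ^ 2),
      sq_nonneg (‖Pplus g x‖ ^ 2)]
  have h := cs (a := fun x => ‖u x‖ ^ 2) (b := fun x => ‖Pplus g x‖ ^ 2)
    (by simpa only [← pow_mul] using! hui) (by simpa only [← pow_mul] using! hPi) hi
  simp only [← pow_mul, Nat.reduceMul, ← hU] at h
  simp only [norm_mul, mul_pow]
  refine ⟨hc, hi, ?_⟩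
  refine abs_le_of_sq_le_sq' ?_ (by positivity) |>.2
  have h8 : U * ∫ x, ‖Pplus g x‖ ^ 4 ≤ U * (8 * (N ^ 2 * U)) :=
    mul_le_mul_of_nonneg_left (hP.trans (by linarith)) hU0
  have h9 : 0 ≤ (N * U) ^ 2 := sq_nonneg _
  nlinarith

end LaxAux

/-- `H¹ → L²` bound for the nonlinear part of the Lax operator (deep-water case):
`‖u·P₊(conj(u)·f)‖_{L²} ≤ C‖u‖²_{L⁴}‖f‖_{H¹}`; consequently
`‖−i f′ + β u P₊(conj(u) f)‖_{L²} ≤ (1 + C‖u‖²_{L⁴})‖f‖_{H¹}` for `|β| ≤ 1`. -/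
theorem lax_nonlinear_H1_L2 :
    ∃ C : ℝ, 0 < C ∧ ∀ u f : SchwartzMap ℝ ℂ,
      ((∫ x : ℝ, ‖u x * Pplus (fun y => (starRingEnd ℂ) (u y) * f y) x‖ ^ 2) ^ (1/2 : ℝ) ≤
          C * (∫ x : ℝ, ‖u x‖ ^ 4) ^ (1/2 : ℝ) *
            ((∫ x : ℝ, ‖f x‖ ^ 2) + (∫ x : ℝ, ‖deriv (⇑f) x‖ ^ 2)) ^ (1/2 : ℝ)) ∧
      (∀ β : ℝ, |β| ≤ 1 →
        (∫ x : ℝ, ‖-Complex.I * deriv (⇑f) x +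
            (β : ℂ) * u x * Pplus (fun y => (starRingEnd ℂ) (u y) * f y) x‖ ^ 2) ^ (1/2 : ℝ) ≤
          (1 + C * (∫ x : ℝ, ‖u x‖ ^ 4) ^ (1/2 : ℝ)) *
            ((∫ x : ℝ, ‖f x‖ ^ 2) + (∫ x : ℝ, ‖deriv (⇑f) x‖ ^ 2)) ^ (1/2 : ℝ)) := by
  refine ⟨2, by norm_num, fun u f => ?_⟩
  obtain ⟨hc, hi, hW⟩ := LaxAux.main u f
  set P := Pplus (fun y => (starRingEnd ℂ) (u y) * f y) with hP
  set U := ∫ x : ℝ, ‖u x‖ ^ 4 with hU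
  set D := ∫ x : ℝ, ‖deriv (⇑f) x‖ ^ 2 with hD
  set M := ∫ x : ℝ, ‖f x‖ ^ 2 with hM
  set W := ∫ x : ℝ, ‖u x * P x‖ ^ 2 with hWd
  have hU0 : 0 ≤ U := integral_nonneg fun _ => by positivity
  have hD0 : 0 ≤ D := integral_nonneg fun _ => by positivity
  have hM0 : 0 ≤ M := integral_nonneg fun _ => by positivity
  have hW0 : 0 ≤ W := integral_nonneg fun _ => by positivity
  simp only [← Real.sqrt_eq_rpow]
  have key : Real.sqrt W ≤ 2 * Real.sqrt U * Real.sqrt (M + D) := by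
    apply Real.sqrt_le_iff.2 ⟨by positivity, ?_⟩
    rw [mul_pow, mul_pow, Real.sq_sqrt hU0, Real.sq_sqrt (by positivity)]
    linarith
  refine ⟨key, fun β hβ => ?_⟩
  have hdi := LaxAux.schwartz_pow (SchwartzMap.derivCLM ℂ ℂ f) 1
  have hdc := (SchwartzMap.derivCLM ℂ ℂ f).continuous
  have hde : ⇑(SchwartzMap.derivCLM ℂ ℂ f) = deriv f := by
    ext x; exact SchwartzMap.derivCLM_apply ℂ f x
  rw [hde] at hdi hdc
  simp only [Nat.reduceAdd] at hdi
  have huc := u.continuous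
  have hprod : Integrable fun x => ‖deriv f x‖ * ‖u x * P x‖ := by
    refine (hdi.add hi).mono' (by fun_prop) ?_
    filter_upwards with x
    rw [Real.norm_of_nonneg (by positivity)]
    simp only [Pi.add_apply]
    nlinarith [sq_nonneg (‖deriv f x‖ - ‖u x * P x‖), sq_nonneg (‖deriv f x‖),
      sq_nonneg (‖u x * P x‖)]
  have hcs := LaxAux.cs hdi hi hprod
  rw [← hD, ← hWd] at hcs
  have hcs' : ∫ x, ‖deriv f x‖ * ‖u x * P x‖ ≤ Real.sqrt D * Real.sqrt W := by
    rw [← Real.sqrt_mul hD0]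
    exact Real.le_sqrt_of_sq_le hcs
  have hpt : ∀ x, ‖-Complex.I * deriv (⇑f) x + (β : ℂ) * u x * P x‖ ^ 2 ≤
      (‖deriv f x‖ ^ 2 + 2 * (‖deriv f x‖ * ‖u x * P x‖)) + ‖u x * P x‖ ^ 2 := by
    intro x
    have h1 : ‖-Complex.I * deriv (⇑f) x + (β : ℂ) * u x * P x‖ ≤
        ‖deriv f x‖ + ‖u x * P x‖ := by
      refine (norm_add_le _ _).trans ?_
      rw [mul_assoc (β : ℂ), norm_mul, norm_mul (β : ℂ), norm_neg, norm_I, one_mul, norm_real,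
        Real.norm_eq_abs]
      have := norm_nonneg (u x * P x)
      nlinarith
    have := pow_le_pow_left₀ (norm_nonneg _) h1 2
    linarith
  have hs1 : Integrable fun x => ‖deriv f x‖ ^ 2 + 2 * (‖deriv f x‖ * ‖u x * P x‖) :=
    hdi.add (hprod.const_mul 2)
  have hs : Integrable fun x => (‖deriv f x‖ ^ 2 + 2 * (‖deriv f x‖ * ‖u x * P x‖)) +
      ‖u x * P x‖ ^ 2 := hs1.add hi
  have hle : ∫ x, ‖-Complex.I * deriv (⇑f) x + (β : ℂ) * u x * P x‖ ^ 2 ≤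
      (Real.sqrt D + Real.sqrt W) ^ 2 := by
    refine (integral_mono_of_nonneg (Filter.Eventually.of_forall fun x => by positivity) hs
      (Filter.Eventually.of_forall hpt)).trans ?_
    rw [integral_add hs1 hi, integral_add hdi (hprod.const_mul 2), integral_const_mul,
      ← hD, ← hWd]
    nlinarith [Real.sq_sqrt hD0, Real.sq_sqrt hW0]
  have h5 : Real.sqrt D ≤ Real.sqrt (M + D) := Real.sqrt_le_sqrt (by linarith)
  calc _ ≤ Real.sqrt ((Real.sqrt D + Real.sqrt W) ^ 2) := Real.sqrt_le_sqrt hle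
    _ = Real.sqrt D + Real.sqrt W := Real.sqrt_sq (by positivity)
    _ ≤ _ := by linarith
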